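/- Let a(s) = s³ + a₁s² + a₂s + a₃ and b(s) = s³ + b₁s² + b₂s + b₃ be Hurwitz stable monic real cubics such that λb(s) + (1-λ)a(s) is Hurwitz stable for all λ ∈ [0,1]. Then there exists a real polynomial c(s) of degree 3 such that c(s)/a(s) and c(s)/b(s) are both strictly positive real. -/

import Mathlib

open Polynomial Complex

noncomputable def evalI (p : Polynomial ℝ) (ω : ℝ) : ℂ :=
  Polynomial.aeval ((ω : ℂ) * Complex.I) p

def HurwitzStable (p : Polynomial ℝ) : Prop :=
  ∀ z : ℂ, Polynomial.aeval z p = 0 → z.re < 0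

def SPR (p q : Polynomial ℝ) : Prop :=
  p.degree = q.degree ∧ HurwitzStable q ∧
    ∀ ω : ℝ, 0 < (evalI p ω / evalI q ω).re

/-- The closed convex cone generated by the moment vectors `(1, w, w²)` with `0 ≤ w`. -/
def momentCone : Set (ℝ × ℝ × ℝ) :=
  {m | 0 ≤ m.1 ∧ 0 ≤ m.2.1 ∧ 0 ≤ m.2.2 ∧ m.2.1 ^ 2 ≤ m.1 * m.2.2}

lemma isClosed_momentCone : IsClosed momentCone := by
  have h0 : Continuous fun m : ℝ × ℝ × ℝ => m.1 := by fun_prop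
  have h1 : Continuous fun m : ℝ × ℝ × ℝ => m.2.1 := by fun_prop
  have h2 : Continuous fun m : ℝ × ℝ × ℝ => m.2.2 := by fun_prop
  exact (isClosed_le continuous_const h0).inter ((isClosed_le continuous_const h1).inter
    ((isClosed_le continuous_const h2).inter (isClosed_le (h1.pow 2) (h0.mul h2))))

lemma smul_mem_momentCone {t : ℝ} (ht : 0 ≤ t) {m : ℝ × ℝ × ℝ} (hm : m ∈ momentCone) :
    t • m ∈ momentCone := by
  obtain ⟨h0, h1, h2, h⟩ := hm
  refine ⟨mul_nonneg ht h0, mul_nonneg ht h1, mul_nonneg ht h2, ?_⟩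
  simp only [Prod.smul_fst, Prod.smul_snd, smul_eq_mul]
  nlinarith [mul_le_mul_of_nonneg_left h (sq_nonneg t)]

lemma add_mem_momentCone {m n : ℝ × ℝ × ℝ} (hm : m ∈ momentCone) (hn : n ∈ momentCone) :
    m + n ∈ momentCone := by
  obtain ⟨m0, m1, m2⟩ := m
  obtain ⟨n0, n1, n2⟩ := n
  obtain ⟨hm0, hm1, hm2, hm⟩ := hm
  obtain ⟨hn0, hn1, hn2, hn⟩ := hn
  refine ⟨add_nonneg hm0 hn0, add_nonneg hm1 hn1, add_nonneg hm2 hn2, ?_⟩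
  simp only [Prod.mk_add_mk] at *
  have hcross : (2 * (m1 * n1)) ^ 2 ≤ (m0 * n2 + n0 * m2) ^ 2 := by
    nlinarith [mul_le_mul hm hn (sq_nonneg n1) (mul_nonneg hm0 hm2),
      sq_nonneg (m0 * n2 - n0 * m2)]
  have := le_of_sq_le_sq hcross (add_nonneg (mul_nonneg hm0 hn2) (mul_nonneg hn0 hm2))
  nlinarith

lemma convex_momentCone : Convex ℝ momentCone := fun _ hm _ hn _ _ hs ht _ =>
  add_mem_momentCone (smul_mem_momentCone hs hm) (smul_mem_momentCone ht hn)

/-- A compact convex base of the product of two moment cones. -/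
def momentBase : Set ((ℝ × ℝ × ℝ) × (ℝ × ℝ × ℝ)) :=
  (momentCone ×ˢ momentCone) ∩ {p | p.1.1 + p.1.2.2 + (p.2.1 + p.2.2.2) = 1}

lemma convex_momentBase : Convex ℝ momentBase := by
  refine (convex_momentCone.prod convex_momentCone).inter ?_
  intro p hp q hq s t _ _ hst
  simp only [Set.mem_ofPred_eq, Prod.fst_add, Prod.snd_add, Prod.smul_fst, Prod.smul_snd,
    smul_eq_mul] at *
  linear_combination s * hp + t * hq + hst

lemma isCompact_momentBase : IsCompact momentBase := by
  refine (isCompact_Icc (a := ((0, 0, 0), (0, 0, 0)))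
    (b := ((1, 1, 1), (1, 1, 1)))).of_isClosed_subset
    ((isClosed_momentCone.prod isClosed_momentCone).inter
      (isClosed_eq (by fun_prop) continuous_const)) ?_
  rintro ⟨⟨m0, m1, m2⟩, n0, n1, n2⟩ ⟨⟨⟨hm0, hm1, hm2, hm⟩, hn0, hn1, hn2, hn⟩, hsum⟩
  simp only [Set.mem_ofPred_eq] at *
  refine ⟨⟨⟨hm0, hm1, hm2⟩, hn0, hn1, hn2⟩, ⟨?_, ?_, ?_⟩, ?_, ?_, ?_⟩ <;>
    dsimp only <;> nlinarith

/-- The linear form in the coefficients `(c₂, c₃, c₁)` of `c = c₁ s² + c₂ s + c₃` which, at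
the moment vector `(1, ω², ω⁴)`, is the real part of `c(jω)` times the conjugate of `a(jω)`, where
`a = s³ + a₁ s² + a₂ s + a₃`. -/
def momentMap (a₁ a₂ a₃ : ℝ) (m : ℝ × ℝ × ℝ) : ℝ × ℝ × ℝ :=
  (a₂ * m.2.1 - m.2.2, a₃ * m.1 - a₁ * m.2.1, a₁ * m.2.2 - a₃ * m.2.1)

lemma momentMap_add_ne_zero {a₁ a₂ a₃ b₁ b₂ b₃ : ℝ}
    (ha₁ : 0 < a₁) (ha₃ : 0 < a₃) (ha : a₃ < a₁ * a₂)
    (hb₁ : 0 < b₁) (hb₃ : 0 < b₃) (hb : b₃ < b₁ * b₂)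
    (hseg : ∀ s t : ℝ, 0 ≤ s → 0 ≤ t → 0 < s + t →
      (s + t) * (s * a₃ + t * b₃) < (s * a₁ + t * b₁) * (s * a₂ + t * b₂))
    {p : (ℝ × ℝ × ℝ) × (ℝ × ℝ × ℝ)} (hp : p ∈ momentBase) :
    momentMap a₁ a₂ a₃ p.1 + momentMap b₁ b₂ b₃ p.2 ≠ 0 := by
  obtain ⟨⟨m0, m1, m2⟩, n0, n1, n2⟩ := p
  obtain ⟨⟨⟨hm0, hm1, hm2, hm⟩, hn0, hn1, hn2, hn⟩, hsum⟩ := hp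
  intro h
  simp only [momentMap, Prod.mk_add_mk, Prod.mk_eq_zero, Set.mem_ofPred_eq] at *
  obtain ⟨e1, e2, e3⟩ := h
  rcases (add_nonneg hm1 hn1).eq_or_lt with h0 | hpos
  · have hm1' : m1 = 0 := by linarith
    have hn1' : n1 = 0 := by linarith
    subst hm1' hn1'
    have h1 : m0 = 0 := by nlinarith [mul_nonneg ha₃.le hm0, mul_nonneg hb₃.le hn0]
    have h2 : n0 = 0 := by nlinarith [mul_nonneg ha₃.le hm0, mul_nonneg hb₃.le hn0]
    linarith
  · have hf := hseg m1 n1 hm1 hn1 hpos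
    set T := a₁ * m2 - a₃ * m1 with hT
    have hTneg : (a₁ - b₁) * T < 0 := by
      have key : (a₁ - b₁) * T =
          -(b₁ * (a₁ * a₂ - a₃) * m1 + a₁ * (b₁ * b₂ - b₃) * n1) := by
        rw [hT]; linear_combination (a₁ * b₁) * e1 + a₁ * e3
      have hP : 0 < b₁ * (a₁ * a₂ - a₃) := mul_pos hb₁ (sub_pos.2 ha)
      have hQ : 0 < a₁ * (b₁ * b₂ - b₃) := mul_pos ha₁ (sub_pos.2 hb)
      rw [key, neg_lt_zero]
      rcases hm1.eq_or_lt with h | h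
      · rw [← h] at hpos ⊢
        have := mul_pos hQ (show 0 < n1 by linarith)
        linarith
      · have := mul_pos hP h
        have := mul_nonneg hQ.le hn1
        linarith
    have hDpos : 0 < (a₁ - b₁) * (m1 * n2 - n1 * m2) := by
      have key : (a₁ - b₁) * (m1 * n2 - n1 * m2) =
          (m1 * a₁ + n1 * b₁) * (m1 * a₂ + n1 * b₂) - (m1 + n1) * (m1 * a₃ + n1 * b₃) := by
        linear_combination -(m1 + n1) * e3 - (a₁ * m1 + b₁ * n1) * e1
      linarith
    have hTD : 0 ≤ T * (m1 * n2 - n1 * m2) := by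
      have key : T * (m1 * n2 - n1 * m2) =
          a₃ * n2 * (m0 * m2 - m1 ^ 2) + b₃ * m2 * (n0 * n2 - n1 ^ 2) := by
        rw [hT]; linear_combination (-m2 * n2) * e2 - (n1 * m2) * e3
      rw [key]
      have := sub_nonneg.2 hm
      have := sub_nonneg.2 hn
      positivity
    nlinarith [mul_neg_of_neg_of_pos hTneg hDpos, mul_nonneg (sq_nonneg (a₁ - b₁)) hTD]

/-- Existence of a quadratic `c₁ s² + c₂ s + c₃` whose product with the conjugates of two cubics has
real part uniformly positive on the imaginary axis. -/
lemma exists_quadratic_uniformly_pos {a₁ a₂ a₃ b₁ b₂ b₃ : ℝ}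
    (h : ∀ p ∈ momentBase, momentMap a₁ a₂ a₃ p.1 + momentMap b₁ b₂ b₃ p.2 ≠ 0) :
    ∃ c₁ c₂ c₃ δ : ℝ, 0 < δ ∧ ∀ w : ℝ, 0 ≤ w →
      δ * (1 + w ^ 2) <
        c₂ * (a₂ * w - w ^ 2) + c₃ * (a₃ - a₁ * w) + c₁ * (a₁ * w ^ 2 - a₃ * w) ∧
      δ * (1 + w ^ 2) <
        c₂ * (b₂ * w - w ^ 2) + c₃ * (b₃ - b₁ * w) + c₁ * (b₁ * w ^ 2 - b₃ * w) := by
  let L : (ℝ × ℝ × ℝ) × (ℝ × ℝ × ℝ) → ℝ × ℝ × ℝ :=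
    fun p => momentMap a₁ a₂ a₃ p.1 + momentMap b₁ b₂ b₃ p.2
  have hlin : IsLinearMap ℝ L := by
    constructor
    · intro p q
      ext <;> simp [L, momentMap] <;> ring
    · intro t p
      ext <;> simp [L, momentMap] <;> ring
  have hcont : Continuous L := by
    unfold L momentMap
    fun_prop
  have hconv : Convex ℝ (L '' momentBase) := convex_momentBase.is_linear_image hlin
  have hclosed : IsClosed (L '' momentBase) := (isCompact_momentBase.image hcont).isClosed
  have hzero : (0 : ℝ × ℝ × ℝ) ∉ L '' momentBase := by
    rintro ⟨p, hp, hp0⟩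
    exact h p hp hp0
  obtain ⟨f, u, hu, hf⟩ := geometric_hahn_banach_point_closed hconv hclosed hzero
  rw [map_zero] at hu
  have hfexp : ∀ x y z : ℝ, f (x, y, z) = f (1, 0, 0) * x + f (0, 1, 0) * y + f (0, 0, 1) * z := by
    intro x y z
    have : ((x, y, z) : ℝ × ℝ × ℝ) = x • (1, 0, 0) + y • (0, 1, 0) + z • (0, 0, 1) := by
      simp
    rw [this, map_add, map_add, map_smul, map_smul, map_smul]
    simp only [smul_eq_mul]
    ring
  refine ⟨f (0, 0, 1), f (1, 0, 0), f (0, 1, 0), u, hu, fun w hw => ?_⟩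
  have hw2 : 0 < 1 + w ^ 2 := by positivity
  have hmem : (1 / (1 + w ^ 2), w / (1 + w ^ 2), w ^ 2 / (1 + w ^ 2)) ∈ momentCone := by
    refine ⟨by positivity, by positivity, by positivity, le_of_eq ?_⟩
    field_simp
  have hmem0 : ((0, 0, 0) : ℝ × ℝ × ℝ) ∈ momentCone := by simp [momentCone]
  have hsum : 1 / (1 + w ^ 2) + w ^ 2 / (1 + w ^ 2) = 1 := by field_simp
  have hA := hf _ ⟨(_, _), ⟨⟨hmem, hmem0⟩, by simpa using hsum⟩, rfl⟩
  have hB := hf _ ⟨(_, _), ⟨⟨hmem0, hmem⟩, by simpa using hsum⟩, rfl⟩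
  simp only [L, momentMap, Prod.mk_add_mk] at hA hB
  rw [hfexp] at hA hB
  constructor
  · refine (mul_lt_mul_of_pos_right hA hw2).trans_eq ?_
    field_simp
    ring
  · refine (mul_lt_mul_of_pos_right hB hw2).trans_eq ?_
    field_simp
    ring

/-- Every real monic cubic has a real root. -/
lemma exists_real_root_cubic (a₁ a₂ a₃ : ℝ) : ∃ x : ℝ, x ^ 3 + a₁ * x ^ 2 + a₂ * x + a₃ = 0 := by
  set M := 1 + |a₁| + |a₂| + |a₃| with hM
  have h1 := abs_nonneg a₁
  have h2 := abs_nonneg a₂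
  have h3 := abs_nonneg a₃
  have hM1 : 1 ≤ M := by linarith
  have hMM : M ≤ M ^ 2 := by nlinarith
  have b1 : |a₁ * M ^ 2| ≤ |a₁| * M ^ 2 := by rw [abs_mul, abs_of_nonneg (sq_nonneg M)]
  have b2 : |a₂ * M| ≤ |a₂| * M ^ 2 := by
    rw [abs_mul, abs_of_nonneg (by linarith : 0 ≤ M)]
    exact mul_le_mul_of_nonneg_left hMM h2
  have b3 : |a₃| ≤ |a₃| * M ^ 2 := by nlinarith
  have hcube : M ^ 3 = M ^ 2 + |a₁| * M ^ 2 + |a₂| * M ^ 2 + |a₃| * M ^ 2 := by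
    linear_combination M ^ 2 * hM
  obtain ⟨l1, u1⟩ := abs_le.1 b1
  obtain ⟨l2, u2⟩ := abs_le.1 b2
  obtain ⟨l3, u3⟩ := abs_le.1 b3
  have hcont : Continuous fun x : ℝ => x ^ 3 + a₁ * x ^ 2 + a₂ * x + a₃ := by fun_prop
  have hzero := intermediate_value_Icc (show -M ≤ M by linarith) hcont.continuousOn
    (show (0 : ℝ) ∈ _ from ⟨by nlinarith, by nlinarith⟩)
  obtain ⟨x, _, hx⟩ := hzero
  exact ⟨x, hx⟩

/-- The coefficients of a real monic quadratic with all roots in the open left half plane are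
positive. -/
lemma quadratic_coeffs_pos {p q : ℝ} (h : ∀ z : ℂ, z ^ 2 + p * z + q = 0 → z.re < 0) :
    0 < p ∧ 0 < q := by
  constructor
  · obtain ⟨d, hd⟩ := IsAlgClosed.exists_pow_nat_eq ((p : ℂ) ^ 2 - 4 * q) (n := 2) (by norm_num)
    have h1 := h ((-p + d) / 2) (by linear_combination hd / 4)
    have h2 := h ((-p - d) / 2) (by linear_combination hd / 4)
    have e : ((-p + d) / 2 : ℂ) + (-p - d) / 2 = ((-p : ℝ) : ℂ) := by push_cast; ring
    have := congrArg Complex.re e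
    rw [Complex.add_re, Complex.ofReal_re] at this
    linarith
  · by_contra! hq
    have hD : 0 ≤ p ^ 2 - 4 * q := by nlinarith
    have hs := Real.sq_sqrt hD
    have h1 := h (((-p + √(p ^ 2 - 4 * q)) / 2 : ℝ) : ℂ) (by
      norm_cast
      linear_combination hs / 4)
    rw [Complex.ofReal_re] at h1
    have := Real.abs_le_sqrt (show p ^ 2 ≤ p ^ 2 - 4 * q by linarith)
    linarith [le_abs_self p]

/-- The necessary half of the Routh–Hurwitz criterion for cubics. -/
lemma HurwitzStable.cubic_coeffs {a₁ a₂ a₃ : ℝ}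
    (h : HurwitzStable (X ^ 3 + C a₁ * X ^ 2 + C a₂ * X + C a₃)) :
    0 < a₁ ∧ 0 < a₃ ∧ a₃ < a₁ * a₂ := by
  have hroot : ∀ z : ℂ, z ^ 3 + a₁ * z ^ 2 + a₂ * z + a₃ = 0 → z.re < 0 := fun z hz =>
    h z (by simpa using hz)
  obtain ⟨x, hx⟩ := exists_real_root_cubic a₁ a₂ a₃
  have hxneg : x < 0 := by simpa using hroot x (by exact_mod_cast hx)
  have hxC : (x : ℂ) ^ 3 + a₁ * x ^ 2 + a₂ * x + a₃ = 0 := by exact_mod_cast hx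
  obtain ⟨hp, hq⟩ := quadratic_coeffs_pos (p := a₁ + x) (q := a₂ + x * (a₁ + x)) (by
    intro z hz
    push_cast at hz
    exact hroot z (by linear_combination (z - x) * hz + hxC))
  have hr : 0 < -x := by linarith
  have h3 : a₃ = -x * (a₂ + x * (a₁ + x)) := by linear_combination hx
  refine ⟨by linarith, h3 ▸ mul_pos hr hq, ?_⟩
  have : a₁ * a₂ - a₃ =
      (a₁ + x) * ((-x) ^ 2 + (-x) * (a₁ + x) + (a₂ + x * (a₁ + x))) := by
    rw [h3]; ring
  have : 0 < a₁ * a₂ - a₃ := by rw [this]; positivity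
  linarith

lemma spr_cubic {c₀ c₁ c₂ c₃ a₁ a₂ a₃ : ℝ} (hc₀ : c₀ ≠ 0)
    (hH : HurwitzStable (X ^ 3 + C a₁ * X ^ 2 + C a₂ * X + C a₃))
    (h : ∀ w : ℝ, 0 ≤ w → 0 < c₀ * (w ^ 3 - a₂ * w ^ 2) +
      (c₂ * (a₂ * w - w ^ 2) + c₃ * (a₃ - a₁ * w) + c₁ * (a₁ * w ^ 2 - a₃ * w))) :
    SPR (C c₀ * X ^ 3 + C c₁ * X ^ 2 + C c₂ * X + C c₃)
      (X ^ 3 + C a₁ * X ^ 2 + C a₂ * X + C a₃) := by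
  refine ⟨?_, hH, fun ω => ?_⟩
  · rw [degree_cubic hc₀]
    simpa using (degree_cubic (one_ne_zero (α := ℝ)) (b := a₁) (c := a₂) (d := a₃)).symm
  · have heval : ∀ d₀ d₁ d₂ d₃ : ℝ, evalI (C d₀ * X ^ 3 + C d₁ * X ^ 2 + C d₂ * X + C d₃) ω =
        ⟨d₃ - d₁ * ω ^ 2, d₂ * ω - d₀ * ω ^ 3⟩ := by
      intro d₀ d₁ d₂ d₃
      apply Complex.ext <;> simp [evalI, pow_succ] <;> ring
    have hA : evalI (X ^ 3 + C a₁ * X ^ 2 + C a₂ * X + C a₃) ω =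
        ⟨a₃ - a₁ * ω ^ 2, a₂ * ω - ω ^ 3⟩ := by
      simpa using heval 1 a₁ a₂ a₃
    have hne : evalI (X ^ 3 + C a₁ * X ^ 2 + C a₂ * X + C a₃) ω ≠ 0 := fun h0 => by
      simpa using hH _ h0
    have hpos := Complex.normSq_pos.2 hne
    rw [Complex.div_re, ← add_div]
    refine div_pos ?_ hpos
    rw [hA, heval]
    have := h (ω ^ 2) (sq_nonneg ω)
    dsimp only
    linarith

theorem spr_synthesis_deg_three (a₁ a₂ a₃ b₁ b₂ b₃ : ℝ)
    (A B : Polynomial ℝ)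
    (hA : A = Polynomial.X ^ 3 + Polynomial.C a₁ * Polynomial.X ^ 2 +
      Polynomial.C a₂ * Polynomial.X + Polynomial.C a₃)
    (hB : B = Polynomial.X ^ 3 + Polynomial.C b₁ * Polynomial.X ^ 2 +
      Polynomial.C b₂ * Polynomial.X + Polynomial.C b₃)
    (hAH : HurwitzStable A) (hBH : HurwitzStable B)
    (hseg : ∀ lam : ℝ, lam ∈ Set.Icc (0 : ℝ) 1 →
      HurwitzStable (Polynomial.C lam * B + Polynomial.C (1 - lam) * A)) :
    ∃ c : Polynomial ℝ, c.degree = 3 ∧ SPR c A ∧ SPR c B := by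
  subst hA hB
  obtain ⟨ha₁, ha₃, ha⟩ := hAH.cubic_coeffs
  obtain ⟨hb₁, hb₃, hb⟩ := hBH.cubic_coeffs
  have hcone : ∀ s t : ℝ, 0 ≤ s → 0 ≤ t → 0 < s + t →
      (s + t) * (s * a₃ + t * b₃) < (s * a₁ + t * b₁) * (s * a₂ + t * b₂) := by
    intro s t hs ht hst
    set l := t / (s + t) with hl
    have ht' : t = l * (s + t) := by rw [hl]; field_simp
    have hs' : s = (1 - l) * (s + t) := by linarith
    have hstab := hseg l ⟨by positivity, (div_le_one hst).2 (by linarith)⟩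
    have e : C l * (X ^ 3 + C b₁ * X ^ 2 + C b₂ * X + C b₃) +
        C (1 - l) * (X ^ 3 + C a₁ * X ^ 2 + C a₂ * X + C a₃) =
        X ^ 3 + C ((1 - l) * a₁ + l * b₁) * X ^ 2 + C ((1 - l) * a₂ + l * b₂) * X +
          C ((1 - l) * a₃ + l * b₃) := by
      simp only [map_add, map_mul, map_sub, map_one]
      ring
    rw [e] at hstab
    have := mul_lt_mul_of_pos_left hstab.cubic_coeffs.2.2 (pow_pos hst 2)
    generalize s + t = r at *
    rw [hs', ht']
    linarith
  obtain ⟨c₁, c₂, c₃, δ, hδ, hpos⟩ := exists_quadratic_uniformly_pos fun p hp =>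
    momentMap_add_ne_zero ha₁ ha₃ ha hb₁ hb₃ hb hcone hp
  set K := |a₂| + |b₂| + 1 with hK
  have hKpos : 0 < K := by positivity
  set ε := δ / K with hε
  have hεpos : 0 < ε := by positivity
  have hεK : ε * K = δ := by rw [hε]; field_simp
  have hpert : ∀ d w : ℝ, d ≤ K → 0 ≤ w →
      0 ≤ ε * (w ^ 3 - d * w ^ 2) + δ * (1 + w ^ 2) := by
    intro d w hd hw
    have : ε * (w ^ 3 - d * w ^ 2) + δ * (1 + w ^ 2) =
        ε * w ^ 3 + ε * (K - d) * w ^ 2 + δ := by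
      linear_combination (-w ^ 2) * hεK
    rw [this]
    have := sub_nonneg.2 hd
    positivity
  refine ⟨C ε * X ^ 3 + C c₁ * X ^ 2 + C c₂ * X + C c₃, degree_cubic hεpos.ne',
    spr_cubic hεpos.ne' hAH fun w hw => ?_, spr_cubic hεpos.ne' hBH fun w hw => ?_⟩
  · have := hpert a₂ w (by linarith [le_abs_self a₂, abs_nonneg b₂]) hw
    linarith [(hpos w hw).1]
  · have := hpert b₂ w (by linarith [le_abs_self b₂, abs_nonneg a₂]) hw
    linarith [(hpos w hw).2]
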